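/- The entropic regularized optimal transport problem has a unique solution: for probability vectors a ∈ ℝ^n, b ∈ ℝ^m, any cost matrix C ∈ ℝ^{n×m}, and any ε > 0, there exists exactly one π ∈ Π(a,b) minimizing the functional J_ε(P) = ⟨C, P⟩ + ε Σ_{i,j} f(P_{ij}) over Π(a,b), where f(x) = x(log x − 1) for x > 0 and f(0) = 0. -/

import Mathlib

open Finset

/-- The transport polytope `Π(a,b)`: matrices with nonnegative entries whose
row sums equal `a` and whose column sums equal `b`. -/
def TransportPolytope {n m : ℕ} (a : Fin n → ℝ) (b : Fin m → ℝ) :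
    Set (Matrix (Fin n) (Fin m) ℝ) :=
  {P | (∀ i j, 0 ≤ P i j) ∧ (∀ i, ∑ j, P i j = a i) ∧ (∀ j, ∑ i, P i j = b j)}

/-- The Frobenius inner product `⟨P, C⟩ = Σ_{i,j} P_{ij} C_{ij}`. -/
def frobeniusInner {n m : ℕ} (P C : Matrix (Fin n) (Fin m) ℝ) : ℝ :=
  ∑ i, ∑ j, P i j * C i j

/-- The strictly convex integrand `f(x) = x (log x − 1)` of the (negative) entropy,
with the convention `f(0) = 0` (note `Real.log 0 = 0` in Mathlib, so the formula
already yields `0` at `x = 0`). -/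
noncomputable def entropyIntegrand (x : ℝ) : ℝ := x * (Real.log x - 1)

/-- The entropic regularized transport objective
`J_ε(P) = ⟨C, P⟩ + ε Σ_{i,j} f(P_{ij})`. -/
noncomputable def entropicObjective {n m : ℕ} (C : Matrix (Fin n) (Fin m) ℝ) (ε : ℝ)
    (P : Matrix (Fin n) (Fin m) ℝ) : ℝ :=
  frobeniusInner P C + ε * ∑ i, ∑ j, entropyIntegrand (P i j)

lemma continuous_entropyIntegrand : Continuous entropyIntegrand := by
  have h : entropyIntegrand = fun x => x * Real.log x - x := by
    funext x
    simp only [entropyIntegrand]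
    ring
  rw [h]
  exact Real.continuous_mul_log.sub continuous_id

lemma strictConvexOn_entropyIntegrand :
    StrictConvexOn ℝ (Set.Ici 0) entropyIntegrand := by
  refine ⟨convex_Ici 0, fun x hx y hy hxy s t hs ht hst => ?_⟩
  have h := Real.strictConvexOn_mul_log.2 hx hy hxy hs ht hst
  simp only [entropyIntegrand, smul_eq_mul] at h ⊢
  linarith

lemma isClosed_transportPolytope {n m : ℕ} (a : Fin n → ℝ) (b : Fin m → ℝ) :
    IsClosed (TransportPolytope a b) := by
  simp only [TransportPolytope, Set.ofPred_and, Set.ofPred_forall]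
  refine .inter ?_ (.inter ?_ ?_)
  · exact isClosed_iInter fun i => isClosed_iInter fun j =>
      isClosed_le continuous_const (continuous_id.matrix_elem i j)
  · exact isClosed_iInter fun i => isClosed_eq
      (continuous_finsetSum _ fun j _ => continuous_id.matrix_elem i j) continuous_const
  · exact isClosed_iInter fun j => isClosed_eq
      (continuous_finsetSum _ fun i _ => continuous_id.matrix_elem i j) continuous_const

lemma isCompact_transportPolytope {n m : ℕ} (a : Fin n → ℝ) (b : Fin m → ℝ) :
    IsCompact (TransportPolytope a b) := by
  have hbox : IsCompact (Set.univ.pi fun i => Set.univ.pi fun _ => Set.Icc 0 (a i) :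
      Set (Fin n → Fin m → ℝ)) :=
    isCompact_univ_pi fun _ => isCompact_univ_pi fun _ => isCompact_Icc
  refine hbox.of_isClosed_subset (isClosed_transportPolytope a b) ?_
  rintro P ⟨hP, hrow, -⟩ i - j -
  exact ⟨hP i j, (single_le_sum (fun k _ => hP i k) (mem_univ j)).trans_eq (hrow i)⟩

lemma convex_transportPolytope {n m : ℕ} (a : Fin n → ℝ) (b : Fin m → ℝ) :
    Convex ℝ (TransportPolytope a b) := by
  rintro P ⟨hP, hPr, hPc⟩ Q ⟨hQ, hQr, hQc⟩ s t hs ht hst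
  refine ⟨fun i j => ?_, fun i => ?_, fun j => ?_⟩
  · exact add_nonneg (mul_nonneg hs (hP i j)) (mul_nonneg ht (hQ i j))
  · simp [sum_add_distrib, ← mul_sum, hPr, hQr, ← add_mul, hst]
  · simp [sum_add_distrib, ← mul_sum, hPc, hQc, ← add_mul, hst]

lemma outer_mem_transportPolytope {n m : ℕ} {a : Fin n → ℝ} {b : Fin m → ℝ}
    (ha : ∀ i, 0 ≤ a i) (hb : ∀ j, 0 ≤ b j) (ha1 : ∑ i, a i = 1) (hb1 : ∑ j, b j = 1) :
    Matrix.vecMulVec a b ∈ TransportPolytope a b := by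
  refine ⟨fun i j => mul_nonneg (ha i) (hb j), fun i => ?_, fun j => ?_⟩
  · simp [Matrix.vecMulVec_apply, ← mul_sum, hb1]
  · simp [Matrix.vecMulVec_apply, ← sum_mul, ha1]

lemma entropicObjective_eq_sum {n m : ℕ} (C : Matrix (Fin n) (Fin m) ℝ) (ε : ℝ)
    (P : Matrix (Fin n) (Fin m) ℝ) :
    entropicObjective C ε P = ∑ i, ∑ j, (P i j * C i j + ε * entropyIntegrand (P i j)) := by
  simp only [entropicObjective, frobeniusInner, mul_sum, sum_add_distrib]

lemma continuous_entropicObjective {n m : ℕ} (C : Matrix (Fin n) (Fin m) ℝ) (ε : ℝ) :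
    Continuous (entropicObjective C ε) := by
  simp only [funext (entropicObjective_eq_sum C ε)]
  refine continuous_finsetSum _ fun i _ => continuous_finsetSum _ fun j _ => ?_
  have h : Continuous fun P : Matrix (Fin n) (Fin m) ℝ => P i j := continuous_id.matrix_elem i j
  exact (h.mul continuous_const).add
    (continuous_const.mul (continuous_entropyIntegrand.comp h))

lemma strictConvexOn_entropicObjective {n m : ℕ} (a : Fin n → ℝ) (b : Fin m → ℝ)
    (C : Matrix (Fin n) (Fin m) ℝ) {ε : ℝ} (hε : 0 < ε) :
    StrictConvexOn ℝ (TransportPolytope a b) (entropicObjective C ε) := by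
  refine ⟨convex_transportPolytope a b, fun P hP Q hQ hPQ s t hs ht hst => ?_⟩
  have hle (i j) : entropyIntegrand (s * P i j + t * Q i j) ≤
      s * entropyIntegrand (P i j) + t * entropyIntegrand (Q i j) :=
    strictConvexOn_entropyIntegrand.convexOn.2 (hP.1 i j) (hQ.1 i j) hs.le ht.le hst
  obtain ⟨i₀, j₀, hij⟩ : ∃ i j, P i j ≠ Q i j := by
    contrapose! hPQ
    exact Matrix.ext hPQ
  have hlt : entropyIntegrand (s * P i₀ j₀ + t * Q i₀ j₀) <
      s * entropyIntegrand (P i₀ j₀) + t * entropyIntegrand (Q i₀ j₀) :=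
    strictConvexOn_entropyIntegrand.2 (hP.1 i₀ j₀) (hQ.1 i₀ j₀) hij hs ht hst
  simp only [entropicObjective_eq_sum, smul_eq_mul, Matrix.add_apply, Matrix.smul_apply,
    mul_sum, ← sum_add_distrib]
  have hterm (i j) : (s * P i j + t * Q i j) * C i j +
        ε * entropyIntegrand (s * P i j + t * Q i j) ≤
      s * (P i j * C i j + ε * entropyIntegrand (P i j)) +
        t * (Q i j * C i j + ε * entropyIntegrand (Q i j)) := by
    linarith [mul_le_mul_of_nonneg_left (hle i j) hε.le]
  refine sum_lt_sum (fun i _ => sum_le_sum fun j _ => hterm i j)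
    ⟨i₀, mem_univ _, sum_lt_sum (fun j _ => hterm i₀ j) ⟨j₀, mem_univ _, ?_⟩⟩
  linarith [mul_lt_mul_of_pos_left hlt hε]

theorem entropic_ot_exists_unique_minimizer
    {n m : ℕ} (a : Fin n → ℝ) (b : Fin m → ℝ)
    (ha : ∀ i, 0 ≤ a i) (hb : ∀ j, 0 ≤ b j)
    (ha1 : ∑ i, a i = 1) (hb1 : ∑ j, b j = 1)
    (C : Matrix (Fin n) (Fin m) ℝ) (ε : ℝ) (hε : 0 < ε) :
    ∃! π : Matrix (Fin n) (Fin m) ℝ,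
      π ∈ TransportPolytope a b ∧
        ∀ P ∈ TransportPolytope a b, entropicObjective C ε π ≤ entropicObjective C ε P := by
  obtain ⟨π, hπ, hmin⟩ := (isCompact_transportPolytope a b).exists_isMinOn
    ⟨_, outer_mem_transportPolytope ha hb ha1 hb1⟩ (continuous_entropicObjective C ε).continuousOn
  refine ⟨π, ⟨hπ, hmin⟩, fun Q hQ => ?_⟩
  exact (strictConvexOn_entropicObjective a b C hε).eq_of_isMinOn hQ.2 hmin hQ.1 hπ
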